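/- Assume N ≥ 4 and p = 1 + 4/(N−3). For c ∈ ℝ let 𝒩(c) denote the number of zeros on (0,1) of the function ρ ↦ u(ρ,c)/u_∞(ρ) − 1. If c₀ ∈ ℝ satisfies u(1,c₀) > 0 and u(1,c₀) ≠ b₀, then 𝒩(c) = 𝒩(c₀) for all c sufficiently close to c₀. -/

import Mathlib

open Set Filter

noncomputable def alphaP (p : ℝ) : ℝ := 2 / (p - 1)

noncomputable def b0 (p : ℝ) : ℝ := (2 * (p + 1) / (p - 1) ^ 2) ^ ((1 : ℝ) / (p - 1))

noncomputable def bInf (N : ℕ) (p : ℝ) : ℝ :=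
  (alphaP p * ((N : ℝ) - 2 - alphaP p)) ^ (alphaP p / 2)

noncomputable def uInf (N : ℕ) (p : ℝ) (ρ : ℝ) : ℝ := bInf N p * ρ ^ (-(alphaP p))

/-- `u` solves `(1-ρ²)u'' + ((N-1)/ρ - 2(α+1)ρ)u' - α(α+1)u + |u|^{p-1}u = 0` on `s`. -/
def IsSolOn (N : ℕ) (p : ℝ) (u : ℝ → ℝ) (s : Set ℝ) : Prop :=
  ∀ ρ ∈ s,
    (1 - ρ ^ 2) * deriv (deriv u) ρ
      + (((N : ℝ) - 1) / ρ - 2 * (alphaP p + 1) * ρ) * deriv u ρ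
      - alphaP p * (alphaP p + 1) * u ρ + |u ρ| ^ (p - 1) * u ρ = 0

open Topology

theorem monotone_of_radial_nonneg {m : ℕ} (hm : m ≠ 0) {y y' y'' : ℝ → ℝ} {r : ℝ}
    (hy : ContinuousOn y (Icc 0 r)) (hy' : ContinuousOn y' (Icc 0 r))
    (h1 : ∀ s ∈ Ioo 0 r, HasDerivAt y (y' s) s) (h2 : ∀ s ∈ Ioo 0 r, HasDerivAt y' (y'' s) s)
    (h : ∀ s ∈ Ioo 0 r, 0 ≤ y'' s + m / s * y' s) :
    MonotoneOn y (Icc 0 r) ∧ ∀ s ∈ Ioc 0 r, 0 ≤ y' s := by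
  have hW : MonotoneOn (fun s => s ^ m * y' s) (Icc 0 r) := by
    apply monotoneOn_of_hasDerivWithinAt_nonneg (convex_Icc 0 r)
      (f' := fun s => m * s ^ (m - 1) * y' s + s ^ m * y'' s)
    · exact (continuousOn_id.pow m).mul hy'
    · intro s hs
      rw [interior_Icc] at hs
      exact ((hasDerivAt_pow m s).mul (h2 s hs)).hasDerivWithinAt
    · intro s hs
      rw [interior_Icc] at hs
      have hs0 : 0 < s := hs.1
      have e : m * s ^ (m - 1) * y' s + s ^ m * y'' s = s ^ m * (y'' s + m / s * y' s) := by
        obtain ⟨k, rfl⟩ := Nat.exists_eq_succ_of_ne_zero hm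
        simp only [Nat.succ_eq_add_one, Nat.add_sub_cancel, pow_succ]
        field_simp
        ring
      rw [e]
      exact mul_nonneg (by positivity) (h s hs)
  have hpos : ∀ s ∈ Ioc 0 r, 0 ≤ y' s := by
    intro s hs
    have := hW ⟨le_rfl, hs.1.le.trans hs.2⟩ ⟨hs.1.le, hs.2⟩ hs.1.le
    simp only [zero_pow hm, zero_mul] at this
    exact nonneg_of_mul_nonneg_right this (pow_pos hs.1 m)
  refine ⟨monotoneOn_of_hasDerivWithinAt_nonneg (convex_Icc 0 r) hy (f' := y') ?_ ?_, hpos⟩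
  · intro s hs
    rw [interior_Icc] at hs
    exact (h1 s hs).hasDerivWithinAt
  · intro s hs
    rw [interior_Icc] at hs
    exact hpos s ⟨hs.1, hs.2.le⟩

/-- `u'' + (m/s) u' = G(u)/(1-s²)` on `(0,1)`, where `u'` is the derivative of `u`. -/
def IsRadialSol (m : ℕ) (G u u' : ℝ → ℝ) : Prop :=
  ∀ s ∈ Ioo (0 : ℝ) 1, HasDerivAt u (u' s) s ∧
    HasDerivAt u' (G (u s) / (1 - s ^ 2) - m / s * u' s) s

theorem IsRadialSol.eq_of_cauchy_data {m : ℕ} {G u u' v v' : ℝ → ℝ}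
    (hG : ∀ R, ∃ L > 0, ∀ x y, |x| ≤ R → |y| ≤ R → |G x - G y| ≤ L * |x - y|)
    (hu : IsRadialSol m G u u') (hv : IsRadialSol m G v v') {z t : ℝ} (ht : 0 < t) (htz : t ≤ z)
    (hz : z < 1) (h0 : u z = v z) (h1 : u' z = v' z) : u t = v t := by
  have hsub : ∀ s ∈ Icc t z, s ∈ Ioo (0 : ℝ) 1 := fun s hs =>
    ⟨ht.trans_le hs.1, hs.2.trans_lt hz⟩
  have cu : ContinuousOn u (Icc t z) := fun s hs =>
    (hu s (hsub s hs)).1.continuousAt.continuousWithinAt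
  have cv : ContinuousOn v (Icc t z) := fun s hs =>
    (hv s (hsub s hs)).1.continuousAt.continuousWithinAt
  obtain ⟨M, hM⟩ := isCompact_Icc.exists_bound_of_continuousOn cu
  obtain ⟨M', hM'⟩ := isCompact_Icc.exists_bound_of_continuousOn cv
  obtain ⟨L, hL, hLip⟩ := hG (max M M')
  have hz2 : 0 < 1 - z ^ 2 := by nlinarith
  set A := L / (1 - z ^ 2) with hA
  have hA0 : 0 ≤ A := by positivity
  set K := 1 + A + 2 * (m / t) with hK
  have hmt : 0 ≤ (m : ℝ) / t := by positivity
  let E : ℝ → ℝ := fun s => ((u s - v s) ^ 2 + (u' s - v' s) ^ 2) * Real.exp (K * s)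
  let E' : ℝ → ℝ := fun s =>
    (2 * (u s - v s) * (u' s - v' s) + 2 * (u' s - v' s) *
      ((G (u s) / (1 - s ^ 2) - m / s * u' s) - (G (v s) / (1 - s ^ 2) - m / s * v' s)))
        * Real.exp (K * s) +
    ((u s - v s) ^ 2 + (u' s - v' s) ^ 2) * (Real.exp (K * s) * K)
  have hE : ∀ s ∈ Icc t z, HasDerivAt E (E' s) s := by
    intro s hs
    obtain ⟨a1, a2⟩ := hu s (hsub s hs)
    obtain ⟨b1, b2⟩ := hv s (hsub s hs)
    have e : HasDerivAt (fun s => Real.exp (K * s)) (Real.exp (K * s) * K) s := by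
      simpa using ((hasDerivAt_id s).const_mul K).exp
    have := ((((a1.sub b1).pow 2).add ((a2.sub b2).pow 2)).mul e)
    refine this.congr_deriv ?_
    simp only [E', Pi.sub_apply, Pi.pow_apply, Pi.add_apply]
    norm_num
  have hmono : MonotoneOn E (Icc t z) := by
    apply monotoneOn_of_hasDerivWithinAt_nonneg (convex_Icc t z) (f' := E')
    · exact fun s hs => (hE s hs).continuousAt.continuousWithinAt
    · exact fun s hs => (hE s (interior_subset hs)).hasDerivWithinAt
    · intro s hs
      replace hs := interior_subset hs
      have hs1 : 0 < 1 - s ^ 2 := by nlinarith [hs.1, hs.2]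
      have hlip := hLip (u s) (v s) ((hM s hs).trans (le_max_left _ _))
        ((hM' s hs).trans (le_max_right _ _))
      have g : |G (u s) / (1 - s ^ 2) - G (v s) / (1 - s ^ 2)| ≤ A * |u s - v s| := by
        rw [← sub_div, abs_div, abs_of_pos hs1, hA, div_mul_eq_mul_div]
        apply div_le_div₀ (by positivity) hlip hz2
        nlinarith [hs.1, hs.2]
      have hms : (m : ℝ) / s ≤ m / t := div_le_div_of_nonneg_left (by positivity) ht hs.1
      set D := u s - v s with hD
      set D' := u' s - v' s with hD'
      have key : 0 ≤ 2 * D * D' + 2 * D' * ((G (u s) / (1 - s ^ 2) - m / s * u' s) -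
          (G (v s) / (1 - s ^ 2) - m / s * v' s)) + (D ^ 2 + D' ^ 2) * K := by
        set g1 := G (u s) / (1 - s ^ 2) - G (v s) / (1 - s ^ 2) with hg1
        have e1 : (G (u s) / (1 - s ^ 2) - m / s * u' s) -
          (G (v s) / (1 - s ^ 2) - m / s * v' s) = g1 - m / s * D' := by
          rw [hg1, hD']; ring
        rw [e1]
        have b1 : |D' * g1| ≤ A * (|D'| * |D|) := by
          rw [abs_mul]; nlinarith [abs_nonneg D']
        have b2 := neg_abs_le (D' * g1)
        have b3 : 2 * (|D'| * |D|) ≤ D ^ 2 + D' ^ 2 := by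
          nlinarith [sq_nonneg (|D'| - |D|), sq_abs D, sq_abs D']
        have b4 : (m : ℝ) / s * D' ^ 2 ≤ m / t * D' ^ 2 := by gcongr
        have b5 : 0 ≤ (m : ℝ) / t * D ^ 2 := by positivity
        have b6 : A * (2 * (|D'| * |D|)) ≤ A * (D ^ 2 + D' ^ 2) := by gcongr
        rw [hK]
        nlinarith [sq_nonneg (D + D')]
      have := mul_nonneg key (Real.exp_pos (K * s)).le
      simp only [E', ← hD, ← hD']
      linarith
  have h2 := hmono ⟨le_rfl, htz⟩ ⟨htz, le_rfl⟩ htz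
  simp only [E, h0, h1, sub_self] at h2
  have h3 : (u t - v t) ^ 2 + (u' t - v' t) ^ 2 ≤ 0 := by
    by_contra hc
    push Not at hc
    have := mul_pos hc (Real.exp_pos (K * t))
    norm_num at h2
    linarith
  have : (u t - v t) ^ 2 = 0 := le_antisymm (by nlinarith [sq_nonneg (u' t - v' t)]) (sq_nonneg _)
  linarith [pow_eq_zero_iff (two_ne_zero) |>.1 this]

theorem encard_zeros_of_strictMonoOn {g : ℝ → ℝ} {s t : ℝ} (hst : s ≤ t)
    (hc : ContinuousOn g (Icc s t)) (hg : StrictMonoOn g (Icc s t)) :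
    {x ∈ Ioc s t | g x = 0}.encard = if g s < 0 ∧ 0 ≤ g t then 1 else 0 := by
  split_ifs with h
  · obtain ⟨x, hx, hx0⟩ := intermediate_value_Icc hst hc ⟨h.1.le, h.2⟩
    have hsx : s < x := lt_of_le_of_ne hx.1 (by rintro rfl; linarith [h.1])
    rw [encard_eq_one]
    refine ⟨x, ?_⟩
    ext y
    simp only [mem_ofPred_eq, mem_singleton_iff]
    constructor
    · rintro ⟨hy, hy0⟩
      exact hg.injOn ⟨hy.1.le, hy.2⟩ hx (hy0.trans hx0.symm)
    · rintro rfl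
      exact ⟨⟨hsx, hx.2⟩, hx0⟩
  · rw [encard_eq_zero, eq_empty_iff_forall_notMem]
    rintro y ⟨hy, hy0⟩
    apply h
    constructor
    · rw [← hy0]; exact hg ⟨le_rfl, hst⟩ ⟨hy.1.le, hy.2⟩ hy.1
    · rw [← hy0]; exact hg.monotoneOn ⟨hy.1.le, hy.2⟩ ⟨hst, le_rfl⟩ hy.2

section Zeros

variable {ι : Type*} {l : Filter ι} {F F' : ι → ℝ → ℝ} {f f' : ℝ → ℝ} {a b : ℝ}

theorem eventually_encard_zeros_eq_of_deriv_pos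
    (hf : ∀ x ∈ Icc a b, HasDerivAt f (f' x) x)
    (hF : ∀ i, ∀ x ∈ Icc a b, HasDerivAt (F i) (F' i x) x)
    (hf' : ContinuousOn f' (Icc a b)) (hU : TendstoUniformlyOn F f l (Icc a b))
    (hU' : TendstoUniformlyOn F' f' l (Icc a b)) {x : ℝ} (hx : x ∈ Icc a b) (hpos : 0 < f' x) :
    ∃ r > 0, ∀ s t, s ∈ Icc a b → t ∈ Icc a b → |s - x| < r → |t - x| < r → s ≤ t →
      f s ≠ 0 → f t ≠ 0 →
      ∀ᶠ i in l, {y ∈ Ioc s t | F i y = 0}.encard = {y ∈ Ioc s t | f y = 0}.encard := by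
  obtain ⟨r, hr, hr'⟩ := Metric.continuousOn_iff.1 hf' x hx (f' x / 2) (by linarith)
  refine ⟨r, hr, fun s t hs ht hsx htx hst hfs hft => ?_⟩
  have hsub : Icc s t ⊆ Icc a b := Icc_subset_Icc hs.1 ht.2
  have hbig : ∀ y ∈ Icc s t, f' x / 2 < f' y := by
    intro y hy
    have := hr' y (hsub hy) (by
      rw [Real.dist_eq, abs_lt]
      constructor <;> linarith [abs_lt.1 hsx, abs_lt.1 htx, hy.1, hy.2])
    rw [Real.dist_eq] at this
    linarith [(abs_lt.1 this).1]
  have mono : ∀ {g g' : ℝ → ℝ}, (∀ y ∈ Icc a b, HasDerivAt g (g' y) y) →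
      (∀ y ∈ Icc s t, 0 < g' y) → ContinuousOn g (Icc s t) ∧ StrictMonoOn g (Icc s t) := by
    intro g g' hg hg'
    have hc : ContinuousOn g (Icc s t) := fun y hy =>
      (hg y (hsub hy)).continuousAt.continuousWithinAt
    exact ⟨hc, strictMonoOn_of_hasDerivWithinAt_pos (convex_Icc s t) hc
      (fun y hy => (hg y (hsub (interior_subset hy))).hasDerivWithinAt)
      (fun y hy => hg' y (interior_subset hy))⟩
  have hsgn : ∀ y ∈ Icc a b, f y ≠ 0 →
      ∀ᶠ i in l, ((F i y < 0 ↔ f y < 0) ∧ (0 ≤ F i y ↔ 0 ≤ f y)) := by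
    intro y hy hne
    rcases lt_or_gt_of_ne hne with h | h
    · filter_upwards [(hU.tendsto_at hy).eventually_lt_const h] with i hi
      exact ⟨by simp [hi, h], by constructor <;> intro <;> linarith⟩
    · filter_upwards [(hU.tendsto_at hy).eventually_const_lt h] with i hi
      exact ⟨by constructor <;> intro <;> linarith, by simp [hi.le, h.le]⟩
  obtain ⟨cf, mf⟩ := mono hf (fun y hy => by linarith [hbig y hy])
  filter_upwards [hsgn s hs hfs, hsgn t ht hft,
    Metric.tendstoUniformlyOn_iff.1 hU' (f' x / 2) (by linarith)] with i hi1 hi2 hi3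
  obtain ⟨cF, mF⟩ := mono (hF i) (fun y hy => by
    have := hi3 y (hsub hy)
    rw [Real.dist_eq] at this
    linarith [(abs_lt.1 this).2, hbig y hy])
  rw [encard_zeros_of_strictMonoOn hst cf mf, encard_zeros_of_strictMonoOn hst cF mF]
  simp only [hi1.1, hi2.2]

theorem eventually_encard_zeros_eq_local
    (hf : ∀ x ∈ Icc a b, HasDerivAt f (f' x) x)
    (hF : ∀ i, ∀ x ∈ Icc a b, HasDerivAt (F i) (F' i x) x)
    (hf' : ContinuousOn f' (Icc a b)) (hU : TendstoUniformlyOn F f l (Icc a b))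
    (hU' : TendstoUniformlyOn F' f' l (Icc a b)) {x : ℝ} (hx : x ∈ Icc a b)
    (hne : f x = 0 → f' x ≠ 0) :
    ∃ r > 0, ∀ s t, s ∈ Icc a b → t ∈ Icc a b → |s - x| < r → |t - x| < r → s ≤ t →
      f s ≠ 0 → f t ≠ 0 →
      ∀ᶠ i in l, {y ∈ Ioc s t | F i y = 0}.encard = {y ∈ Ioc s t | f y = 0}.encard := by
  by_cases h0 : f x = 0
  · rcases lt_or_gt_of_ne (hne h0) with h | h
    · have := eventually_encard_zeros_eq_of_deriv_pos (F := fun i y => -F i y)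
        (F' := fun i y => -F' i y) (f := fun y => -f y) (f' := fun y => -f' y) (l := l)
        (fun x hx => (hf x hx).neg) (fun i x hx => (hF i x hx).neg) hf'.neg
        (by simpa [Metric.tendstoUniformlyOn_iff, dist_neg_neg] using
          Metric.tendstoUniformlyOn_iff.1 hU)
        (by simpa [Metric.tendstoUniformlyOn_iff, dist_neg_neg] using
          Metric.tendstoUniformlyOn_iff.1 hU') hx (by simpa using h)
      simpa only [neg_eq_zero, ne_eq] using this
    · exact eventually_encard_zeros_eq_of_deriv_pos hf hF hf' hU hU' hx h
  · have hpos := abs_pos.2 h0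
    obtain ⟨r, hr, hr'⟩ := Metric.continuousAt_iff.1 (hf x hx).continuousAt (|f x| / 2)
      (by linarith)
    refine ⟨r, hr, fun s t hs ht hsx htx hst _ _ => ?_⟩
    have hbig : ∀ y ∈ Ioc s t, |f x| / 2 < |f y| := by
      intro y hy
      have := hr' (x := y) (by
        rw [Real.dist_eq, abs_lt]
        constructor <;> linarith [abs_lt.1 hsx, abs_lt.1 htx, hy.1, hy.2])
      rw [Real.dist_eq, abs_sub_comm] at this
      linarith [abs_sub_abs_le_abs_sub (f x) (f y)]
    filter_upwards [Metric.tendstoUniformlyOn_iff.1 hU (|f x| / 2) (by linarith)] with i hi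
    have e1 : {y ∈ Ioc s t | F i y = 0} = ∅ := by
      rw [eq_empty_iff_forall_notMem]
      rintro y ⟨hy, hy0⟩
      have := hi y ⟨hs.1.trans hy.1.le, hy.2.trans ht.2⟩
      rw [Real.dist_eq, hy0, sub_zero] at this
      linarith [hbig y hy]
    have e2 : {y ∈ Ioc s t | f y = 0} = ∅ := by
      rw [eq_empty_iff_forall_notMem]
      rintro y ⟨hy, hy0⟩
      have := hbig y hy
      rw [hy0, abs_zero] at this
      linarith
    rw [e1, e2]

theorem encard_zeros_Ioc_add (g : ℝ → ℝ) {r s t : ℝ} (hrs : r ≤ s) (hst : s ≤ t) :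
    {y ∈ Ioc r t | g y = 0}.encard =
      {y ∈ Ioc r s | g y = 0}.encard + {y ∈ Ioc s t | g y = 0}.encard := by
  rw [← encard_union_eq]
  · congr 1
    ext y
    rw [← Ioc_union_Ioc_eq_Ioc hrs hst]
    simp only [mem_ofPred_eq, mem_union, or_and_right]
  · rw [Set.disjoint_left]
    rintro y ⟨hy, _⟩ ⟨hy', _⟩
    exact absurd hy.2 (not_le.2 hy'.1)

/-- The number of zeros is locally constant under `C¹` convergence, if the zeros of the limit are
simple and do not lie at the end points. -/
theorem eventually_encard_zeros_eq (hab : a ≤ b)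
    (hf : ∀ x ∈ Icc a b, HasDerivAt f (f' x) x)
    (hF : ∀ i, ∀ x ∈ Icc a b, HasDerivAt (F i) (F' i x) x)
    (hf' : ContinuousOn f' (Icc a b)) (hU : TendstoUniformlyOn F f l (Icc a b))
    (hU' : TendstoUniformlyOn F' f' l (Icc a b)) (hne : ∀ x ∈ Icc a b, f x = 0 → f' x ≠ 0)
    (ha : f a ≠ 0) (hb : f b ≠ 0) :
    ∀ᶠ i in l, {y ∈ Ioc a b | F i y = 0}.encard = {y ∈ Ioc a b | f y = 0}.encard := by
  let S : Set ℝ := {x ∈ Icc a b | f x ≠ 0 ∧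
    ∀ᶠ i in l, {y ∈ Ioc a x | F i y = 0}.encard = {y ∈ Ioc a x | f y = 0}.encard}
  have haS : a ∈ S := ⟨⟨le_rfl, hab⟩, ha, by simp⟩
  have hSb : BddAbove S := ⟨b, fun x hx => hx.1.2⟩
  set σ := sSup S with hσ
  have hσI : σ ∈ Icc a b := ⟨le_csSup hSb haS, csSup_le ⟨a, haS⟩ fun x hx => hx.1.2⟩
  obtain ⟨r, hr, hloc⟩ := eventually_encard_zeros_eq_local hf hF hf' hU hU' hσI (hne σ hσI)
  obtain ⟨y, hyS, hy⟩ := exists_lt_of_lt_csSup ⟨a, haS⟩ (sub_lt_self σ hr)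
  have hyσ : y ≤ σ := le_csSup hSb hyS
  have ext : ∀ t ∈ Icc a b, σ ≤ t → t < σ + r → f t ≠ 0 → t ∈ S := by
    intro t ht hσt htr hft
    refine ⟨ht, hft, ?_⟩
    filter_upwards [hyS.2.2, hloc y t hyS.1 ht (by rw [abs_lt]; constructor <;> linarith)
      (by rw [abs_lt]; constructor <;> linarith) (hyσ.trans hσt) hyS.2.1 hft] with i h1 h2
    rw [encard_zeros_Ioc_add (F i) hyS.1.1 (hyσ.trans hσt), h1, h2,
      ← encard_zeros_Ioc_add f hyS.1.1 (hyσ.trans hσt)]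
  rcases hσI.2.eq_or_lt with h | h
  · exact (ext b ⟨hab, le_rfl⟩ h.le (by linarith) hb).2.2
  · exfalso
    have hev : ∀ᶠ t in 𝓝[>] σ, f t ≠ 0 := by
      by_cases h0 : f σ = 0
      · have := (hf σ hσI).eventually_ne (c := (0 : ℝ)) (hne σ hσI h0)
        exact this.filter_mono (nhdsWithin_mono _ fun t (ht : σ < t) => ne_of_gt ht)
      · exact ((hf σ hσI).continuousAt.eventually_ne h0).filter_mono nhdsWithin_le_nhds
    obtain ⟨t, ⟨htne, ht⟩⟩ :=
      (hev.and (Ioo_mem_nhdsGT (lt_min h (lt_add_of_pos_right σ hr)))).exists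
    have := le_csSup hSb (ext t ⟨hσI.1.trans ht.1.le, ht.2.le.trans (min_le_left _ _)⟩ ht.1.le
      (ht.2.trans_le (min_le_right _ _)) htne)
    linarith [ht.1]

end Zeros

section Barrier

/-- A primitive of `-log (1 - s)`; its second derivative is `1 / (1 - s)`. -/
noncomputable def barrierExponent (s : ℝ) : ℝ := s + (1 - s) * Real.log (1 - s)

theorem hasDerivAt_barrierExponent {s : ℝ} (hs : s < 1) :
    HasDerivAt barrierExponent (-Real.log (1 - s)) s := by
  have h1 : HasDerivAt (fun s : ℝ => 1 - s) (-1) s := by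
    simpa using (hasDerivAt_id s).const_sub 1
  have hne : 1 - s ≠ 0 := by linarith
  refine ((hasDerivAt_id s).add (h1.mul (h1.log hne))).congr_deriv ?_
  field_simp
  ring

theorem barrierExponent_le_one {s : ℝ} (h0 : 0 ≤ s) (h1 : s < 1) : barrierExponent s ≤ 1 := by
  have : Real.log (1 - s) ≤ 0 := Real.log_nonpos (by linarith) (by linarith)
  unfold barrierExponent
  nlinarith

variable {m : ℕ} {G u u' v v' : ℝ → ℝ} {M L ε : ℝ}

theorem IsRadialSol.barrier_monotone (hm : m ≠ 0) (hu : IsRadialSol m G u u')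
    (hv : IsRadialSol m G v v') (cu : ContinuousOn u (Ico 0 1)) (cv : ContinuousOn v (Ico 0 1))
    (cu' : ContinuousOn u' (Ico 0 1)) (cv' : ContinuousOn v' (Ico 0 1))
    (hM : ∀ s ∈ Ico (0 : ℝ) 1, |v s| ≤ M) (hL : 0 < L)
    (hG : ∀ x y, |x| ≤ M + 1 → |y| ≤ M + 1 → |G x - G y| ≤ L * |x - y|)
    (hε : 0 < ε) (hε1 : ε * Real.exp L ≤ 1) {r : ℝ} (hr : r < 1)
    (hD : ∀ s ∈ Ioo 0 r, |u s - v s| ≤ ε * Real.exp (L * barrierExponent s))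
    {τ : ℝ} (hτ : |τ| = 1) :
    MonotoneOn (fun s => ε * Real.exp (L * barrierExponent s) + τ * (u s - v s)) (Icc 0 r) ∧
      ∀ s ∈ Ioc 0 r, 0 ≤ L * -Real.log (1 - s) * (ε * Real.exp (L * barrierExponent s)) +
        τ * (u' s - v' s) := by
  set B : ℝ → ℝ := fun s => ε * Real.exp (L * barrierExponent s) with hB
  have dB : ∀ s < 1, HasDerivAt B (L * -Real.log (1 - s) * B s) s := by
    intro s hs
    refine (((hasDerivAt_barrierExponent hs).const_mul L).exp.const_mul ε).congr_deriv ?_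
    simp only [hB]
    ring
  have dB1 : ∀ s < 1, HasDerivAt (fun s => L * -Real.log (1 - s) * B s)
      (L / (1 - s) * B s + L * -Real.log (1 - s) * (L * -Real.log (1 - s) * B s)) s := by
    intro s hs
    have h1 : HasDerivAt (fun s : ℝ => 1 - s) (-1) s := by
      simpa using (hasDerivAt_id s).const_sub 1
    have hne : 1 - s ≠ 0 := by linarith
    refine (((h1.log hne).neg.const_mul L).mul (dB s hs)).congr_deriv ?_
    simp only [Pi.neg_apply]
    field_simp
  have hsub : Icc 0 r ⊆ Ico (0 : ℝ) 1 := fun s hs => ⟨hs.1, hs.2.trans_lt hr⟩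
  have hsub' : ∀ s ∈ Ioo 0 r, s ∈ Ioo (0 : ℝ) 1 := fun s hs => ⟨hs.1, hs.2.trans hr⟩
  refine monotone_of_radial_nonneg hm
    (y'' := fun s => L / (1 - s) * B s + L * -Real.log (1 - s) * (L * -Real.log (1 - s) * B s) +
      τ * ((G (u s) / (1 - s ^ 2) - m / s * u' s) - (G (v s) / (1 - s ^ 2) - m / s * v' s)))
    ?_ ?_ ?_ ?_ ?_
  · refine ContinuousOn.add (fun s hs => (dB s (hsub hs).2).continuousAt.continuousWithinAt) ?_
    exact ((cu.sub cv).mono hsub).const_smul τ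
  · refine ContinuousOn.add (fun s hs => (dB1 s (hsub hs).2).continuousAt.continuousWithinAt) ?_
    exact ((cu'.sub cv').mono hsub).const_smul τ
  · intro s hs
    have hs' := hsub' s hs
    exact (dB s hs'.2).add (((hu s hs').1.sub (hv s hs').1).const_mul τ)
  · intro s hs
    have hs' := hsub' s hs
    exact (dB1 s hs'.2).add (((hu s hs').2.sub (hv s hs').2).const_mul τ)
  · intro s hs
    obtain ⟨hs0, hs1⟩ := hsub' s hs
    have hBpos : 0 < B s := by positivity
    have hlog : 0 ≤ -Real.log (1 - s) := by
      have := Real.log_nonpos (x := 1 - s) (by linarith) (by linarith)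
      linarith
    have hB1 : B s ≤ 1 := by
      refine le_trans ?_ hε1
      have := barrierExponent_le_one hs0.le hs1
      simp only [hB]
      gcongr
      nlinarith
    have hvM := hM s ⟨hs0.le, hs1⟩
    have huM : |u s| ≤ M + 1 := by
      have := abs_sub_abs_le_abs_sub (u s) (v s)
      linarith [hD s hs]
    have hlip : |G (u s) - G (v s)| ≤ L * B s :=
      (hG _ _ huM (by linarith)).trans (by gcongr; exact hD s hs)
    have h1s : 0 < 1 - s := by linarith
    have h1s2 : 0 < 1 - s ^ 2 := by nlinarith
    have hquot : |τ * ((G (u s) - G (v s)) / (1 - s ^ 2))| ≤ L / (1 - s) * B s := by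
      rw [abs_mul, hτ, one_mul, abs_div, abs_of_pos h1s2, div_mul_eq_mul_div]
      apply div_le_div₀ (by positivity) hlip h1s
      nlinarith
    have hm0 : 0 ≤ (m : ℝ) / s * (L * -Real.log (1 - s) * B s) := by positivity
    have hsq : 0 ≤ L * -Real.log (1 - s) * (L * -Real.log (1 - s) * B s) := by positivity
    have := neg_abs_le (τ * ((G (u s) - G (v s)) / (1 - s ^ 2)))
    rw [sub_div] at this hquot
    linarith

/-- Continuous dependence on the value at the origin, uniformly up to the singular point `1`. -/
theorem IsRadialSol.abs_sub_le (hm : m ≠ 0) (hu : IsRadialSol m G u u')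
    (hv : IsRadialSol m G v v') (cu : ContinuousOn u (Ico 0 1)) (cv : ContinuousOn v (Ico 0 1))
    (cu' : ContinuousOn u' (Ico 0 1)) (cv' : ContinuousOn v' (Ico 0 1))
    (hM : ∀ s ∈ Ico (0 : ℝ) 1, |v s| ≤ M) (hL : 0 < L)
    (hG : ∀ x y, |x| ≤ M + 1 → |y| ≤ M + 1 → |G x - G y| ≤ L * |x - y|)
    (hε1 : ε * Real.exp L ≤ 1) (h0 : |u 0 - v 0| < ε) :
    ∀ s ∈ Ioo (0 : ℝ) 1, |u s - v s| ≤ ε * Real.exp L ∧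
      |u' s - v' s| ≤ L * -Real.log (1 - s) * (ε * Real.exp L) := by
  have hε : 0 < ε := (abs_nonneg _).trans_lt h0
  have main : ∀ r ∈ Ico (0 : ℝ) 1, |u r - v r| < ε * Real.exp (L * barrierExponent r) := by
    intro r hr
    by_contra hcon
    push Not at hcon
    have hsub : Icc 0 r ⊆ Ico (0 : ℝ) 1 := fun s hs => ⟨hs.1, hs.2.trans_lt hr.2⟩
    have cB : ContinuousOn (fun s => ε * Real.exp (L * barrierExponent s)) (Icc 0 r) := by
      intro s hs
      exact ((hasDerivAt_barrierExponent (hsub hs).2).const_mul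
        L).exp.continuousAt.continuousWithinAt.const_smul ε
    have hcl : IsClosed {s ∈ Icc 0 r | ε * Real.exp (L * barrierExponent s) ≤ |u s - v s|} :=
      isClosed_Icc.isClosed_le cB ((cu.sub cv).mono hsub).abs
    obtain ⟨r₁, ⟨hr₁, hr₁'⟩, hleast⟩ := (isCompact_Icc.of_isClosed_subset hcl
      (sep_subset _ _)).exists_isLeast ⟨r, ⟨hr.1, le_rfl⟩, hcon⟩
    have hbelow : ∀ s ∈ Ioo 0 r₁, |u s - v s| ≤ ε * Real.exp (L * barrierExponent s) := by
      intro s hs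
      by_contra hc
      push Not at hc
      exact absurd (hleast ⟨⟨hs.1.le, hs.2.le.trans hr₁.2⟩, hc.le⟩) (not_le.2 hs.2)
    have hmono := fun {τ : ℝ} (hτ : |τ| = 1) => (hu.barrier_monotone hm hv cu cv cu' cv' hM hL hG
      hε hε1 (hsub hr₁).2 hbelow hτ).1 ⟨le_rfl, hr₁.1⟩ ⟨hr₁.1, le_rfl⟩ hr₁.1
    have e1 := hmono (τ := 1) (by simp)
    have e2 := hmono (τ := -1) (by simp)
    have hb0 : barrierExponent 0 = 0 := by simp [barrierExponent]
    simp only [hb0, mul_zero, Real.exp_zero, mul_one] at e1 e2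
    have := abs_lt.1 h0
    have : |u r₁ - v r₁| < ε * Real.exp (L * barrierExponent r₁) := by
      rw [abs_lt]
      constructor <;> linarith
    linarith
  intro s hs
  have hexp : ε * Real.exp (L * barrierExponent s) ≤ ε * Real.exp L := by
    have := barrierExponent_le_one hs.1.le hs.2
    gcongr
    nlinarith
  refine ⟨(main s ⟨hs.1.le, hs.2⟩).le.trans hexp, ?_⟩
  have hder := fun {τ : ℝ} (hτ : |τ| = 1) => (hu.barrier_monotone hm hv cu cv cu' cv' hM hL hG
      hε hε1 hs.2 (fun t ht => (main t ⟨ht.1.le, ht.2.trans hs.2⟩).le) hτ).2 s ⟨hs.1, le_rfl⟩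
  have e1 := hder (τ := 1) (by simp)
  have e2 := hder (τ := -1) (by simp)
  have hlog : 0 ≤ L * -Real.log (1 - s) := by
    have := Real.log_nonpos (x := 1 - s) (by linarith [hs.2]) (by linarith [hs.1])
    exact mul_nonneg hL.le (by linarith)
  refine le_trans ?_ (mul_le_mul_of_nonneg_left hexp hlog)
  rw [abs_le]
  constructor <;> linarith

end Barrier

theorem hasDerivAt_abs_rpow_mul_self {q : ℝ} (hq : 0 < q) (x : ℝ) :
    HasDerivAt (fun x : ℝ => |x| ^ q * x) ((q + 1) * |x| ^ q) x := by
  rcases eq_or_ne x 0 with rfl | hx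
  · rw [hasDerivAt_iff_tendsto_slope_zero]
    simp only [abs_zero, Real.zero_rpow hq.ne', mul_zero, zero_add, sub_zero]
    have h : Tendsto (fun t : ℝ => |t| ^ q) (𝓝[≠] 0) (𝓝 0) := by
      have : ContinuousAt (fun t : ℝ => |t| ^ q) 0 :=
        (continuous_abs.rpow_const fun _ => Or.inr hq.le).continuousAt
      simpa [ContinuousAt, Real.zero_rpow hq.ne'] using this.tendsto.mono_left nhdsWithin_le_nhds
    refine h.congr' ?_
    filter_upwards [self_mem_nhdsWithin] with t ht
    have ht : t ≠ 0 := ht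
    simp only [smul_eq_mul]
    field_simp
  · have h := ((hasDerivAt_abs hx).rpow_const (p := q) (Or.inl (abs_ne_zero.2 hx))).mul
      (hasDerivAt_id x)
    refine h.congr_deriv ?_
    have e : |x| ^ q = |x| ^ (q - 1) * |x| := by
      rw [← Real.rpow_add_one (abs_ne_zero.2 hx)]
      ring_nf
    have e2 : (SignType.sign x : ℝ) * x = |x| := by
      rw [mul_comm]; exact self_mul_sign x
    simp only [id]
    rw [e, ← e2]
    ring

theorem exists_lipschitz_const_nonlinearity {q : ℝ} (hq : 0 < q) (k R : ℝ) :
    ∃ L > 0, ∀ x y, |x| ≤ R → |y| ≤ R →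
      |(k * x - |x| ^ q * x) - (k * y - |y| ^ q * y)| ≤ L * |x - y| := by
  refine ⟨|k| + (q + 1) * |R| ^ q + 1, by positivity, fun x y hx hy => ?_⟩
  have := (convex_Icc (-R) R).norm_image_sub_le_of_norm_hasDerivWithin_le
    (f := fun x : ℝ => k * x - |x| ^ q * x) (f' := fun x => k * 1 - (q + 1) * |x| ^ q)
    (C := |k| + (q + 1) * |R| ^ q + 1) (x := y) (y := x)
    (fun z _ => (((hasDerivAt_id z).const_mul k).sub
      (hasDerivAt_abs_rpow_mul_self hq z)).hasDerivWithinAt) ?_ (abs_le.1 hy) (abs_le.1 hx)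
  · simpa only [Real.norm_eq_abs] using this
  · intro z hz
    have hz' : |z| ≤ |R| := (abs_le.2 hz).trans (le_abs_self R)
    have h1 : (q + 1) * |z| ^ q ≤ (q + 1) * |R| ^ q := by gcongr
    rw [Real.norm_eq_abs, mul_one]
    refine (abs_sub _ _).trans ?_
    rw [abs_of_nonneg (a := (q + 1) * |z| ^ q) (by positivity)]
    linarith

theorem eventually_encard_intersections_eq {m : ℕ} (hm : m ≠ 0) {G : ℝ → ℝ}
    (hG : ∀ R, ∃ L > 0, ∀ x y, |x| ≤ R → |y| ≤ R → |G x - G y| ≤ L * |x - y|)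
    {u u' : ℝ → ℝ → ℝ} {w w' : ℝ → ℝ} (hu : ∀ c, IsRadialSol m G (u c) (u' c))
    (hw : IsRadialSol m G w w') (cu : ∀ c, ContinuousOn (u c) (Icc 0 1))
    (cu' : ∀ c, ContinuousOn (u' c) (Ico 0 1)) (h0 : ∀ c, u c 0 = c)
    (cw : ContinuousOn w (Ioc 0 1)) (hw0 : Tendsto w (𝓝[>] 0) atTop) {c₀ : ℝ}
    (h1 : u c₀ 1 ≠ w 1) :
    ∀ᶠ c in 𝓝 c₀, {ρ ∈ Ioo (0 : ℝ) 1 | u c ρ - w ρ = 0}.encard =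
      {ρ ∈ Ioo (0 : ℝ) 1 | u c₀ ρ - w ρ = 0}.encard := by
  obtain ⟨M, hM⟩ := isCompact_Icc.exists_bound_of_continuousOn (cu c₀)
  obtain ⟨L, hL, hLip⟩ := hG (M + 1)
  have conv : ∀ b ∈ Ioo (0 : ℝ) 1, ∀ η > 0, ∀ᶠ c in 𝓝 c₀, ∀ s ∈ Ioo (0 : ℝ) 1,
      |u c s - u c₀ s| ≤ η ∧ (s ≤ b → |u' c s - u' c₀ s| ≤ η) := by
    intro b hb η hη
    have hlogb : 0 ≤ -Real.log (1 - b) := by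
      have := Real.log_nonpos (x := 1 - b) (by linarith [hb.2]) (by linarith [hb.1])
      linarith
    set κ := L * -Real.log (1 - b) + 1 with hκ
    have hκ1 : 1 ≤ κ := by rw [hκ]; nlinarith [mul_nonneg hL.le hlogb]
    have hκ0 : 0 < κ := by linarith
    set ε := min 1 (η / κ) / Real.exp L with hε
    have hεL : ε * Real.exp L = min 1 (η / κ) := by rw [hε]; field_simp
    have hε0 : 0 < ε := by positivity
    filter_upwards [Metric.ball_mem_nhds c₀ hε0] with c hc s hs
    rw [Metric.mem_ball, Real.dist_eq] at hc
    obtain ⟨e1, e2⟩ := (hu c).abs_sub_le hm (hu c₀) ((cu c).mono Ico_subset_Icc_self)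
      ((cu c₀).mono Ico_subset_Icc_self) (cu' c) (cu' c₀) (fun s hs => hM s (Ico_subset_Icc_self hs))
      hL hLip (hεL.trans_le (min_le_left _ _)) (by rwa [h0, h0]) s hs
    rw [hεL] at e1 e2
    have hη' : κ * (η / κ) = η := by field_simp
    have hmin := min_le_right 1 (η / κ)
    have hpos : 0 ≤ η / κ := by positivity
    refine ⟨by nlinarith, fun hsb => ?_⟩
    have hlog : -Real.log (1 - s) ≤ -Real.log (1 - b) := by
      have := Real.log_le_log (x := 1 - b) (y := 1 - s) (by linarith [hb.2]) (by linarith)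
      linarith
    have hlogs : 0 ≤ -Real.log (1 - s) := by
      have := Real.log_nonpos (x := 1 - s) (by linarith [hs.2]) (by linarith [hs.1])
      linarith
    calc |u' c s - u' c₀ s| ≤ L * -Real.log (1 - s) * min 1 (η / κ) := e2
      _ ≤ κ * (η / κ) := by
        apply mul_le_mul _ hmin (by positivity) hκ0.le
        rw [hκ]
        nlinarith
      _ = η := hη'
  obtain ⟨a', ha'0, ha'⟩ := mem_nhdsGT_iff_exists_Ioo_subset.1
    (hw0.eventually_gt_atTop (M + 1))
  have ha'0 : 0 < a' := ha'0
  set a := min a' 1 / 2 with ha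
  have hmin0 : 0 < min a' 1 := lt_min ha'0 one_pos
  have ha0 : 0 < a := by positivity
  have haa : a < a' := by linarith [min_le_left a' 1]
  have ha1 : a < 1 := by linarith [min_le_right a' 1]
  have hwa : ∀ ρ, 0 < ρ → ρ ≤ a → M + 1 < w ρ := fun ρ h h' => ha' ⟨h, h'.trans_lt haa⟩
  set d := |u c₀ 1 - w 1| with hd
  have hd0 : 0 < d := abs_pos.2 (sub_ne_zero.2 h1)
  obtain ⟨r, hr, hr'⟩ := Metric.continuousOn_iff.1
    (((cu c₀).mono Ioc_subset_Icc_self).sub cw) 1 ⟨one_pos, le_rfl⟩ (d / 2) (by linarith)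
  obtain ⟨b, hb, hb1⟩ := exists_between (max_lt ha1 (sub_lt_self 1 hr))
  have hab : a < b := (le_max_left _ _).trans_lt hb
  have hrb : 1 - r < b := (le_max_right _ _).trans_lt hb
  have hb0 : 0 < b := ha0.trans hab
  have hwb : ∀ ρ ∈ Ico b 1, d / 2 < |u c₀ ρ - w ρ| := by
    intro ρ hρ
    have := hr' ρ ⟨hb0.trans_le hρ.1, hρ.2.le⟩ (by
      rw [Real.dist_eq, abs_lt]; constructor <;> linarith [hρ.1, hρ.2])
    rw [Real.dist_eq, abs_sub_comm] at this
    have := abs_sub_abs_le_abs_sub (u c₀ 1 - w 1) (u c₀ ρ - w ρ)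
    simp only [Pi.sub_apply] at *
    linarith
  have key : ∀ c, (∀ s ∈ Ioo (0 : ℝ) 1, |u c s - u c₀ s| ≤ min 1 (d / 2)) →
      {ρ ∈ Ioo (0 : ℝ) 1 | u c ρ - w ρ = 0} = {ρ ∈ Ioc a b | u c ρ - w ρ = 0} := by
    intro c hc
    ext ρ
    simp only [mem_ofPred_eq]
    constructor
    · rintro ⟨hρ, h⟩
      have hcρ := hc ρ hρ
      refine ⟨⟨?_, ?_⟩, h⟩
      · by_contra hcon
        push Not at hcon
        have e1 := hwa ρ hρ.1 hcon
        have e2 := hM ρ ⟨hρ.1.le, hρ.2.le⟩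
        rw [Real.norm_eq_abs] at e2
        linarith [le_abs_self (u c ρ - u c₀ ρ), le_abs_self (u c₀ ρ), min_le_left 1 (d / 2)]
      · by_contra hcon
        push Not at hcon
        have e1 := hwb ρ ⟨hcon.le, hρ.2⟩
        have e2 : u c ρ = w ρ := sub_eq_zero.1 h
        rw [e2, abs_sub_comm] at hcρ
        linarith [min_le_right 1 (d / 2)]
    · rintro ⟨hρ, h⟩
      exact ⟨⟨ha0.trans hρ.1, hρ.2.trans_lt hb1⟩, h⟩
  have hsub : ∀ s ∈ Icc a b, s ∈ Ioo (0 : ℝ) 1 := fun s hs =>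
    ⟨ha0.trans_le hs.1, hs.2.trans_lt hb1⟩
  have count := eventually_encard_zeros_eq (l := 𝓝 c₀) (F := fun c ρ => u c ρ - w ρ)
    (F' := fun c ρ => u' c ρ - w' ρ) (f := fun ρ => u c₀ ρ - w ρ)
    (f' := fun ρ => u' c₀ ρ - w' ρ) hab.le
    (fun x hx => ((hu c₀ x (hsub x hx)).1.sub (hw x (hsub x hx)).1))
    (fun c x hx => ((hu c x (hsub x hx)).1.sub (hw x (hsub x hx)).1))
    (fun x hx => ((hu c₀ x (hsub x hx)).2.sub
      (hw x (hsub x hx)).2).continuousAt.continuousWithinAt) ?_ ?_ ?_ ?_ ?_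
  · filter_upwards [count, conv b ⟨hb0, hb1⟩ (min 1 (d / 2)) (by positivity)] with c hc hc'
    rw [key c fun s hs => (hc' s hs).1, key c₀ fun s _ => by simp; positivity, hc]
  · rw [Metric.tendstoUniformlyOn_iff]
    intro η hη
    filter_upwards [conv b ⟨hb0, hb1⟩ (η / 2) (by positivity)] with c hc s hs
    rw [Real.dist_eq, abs_sub_comm, sub_sub_sub_cancel_right]
    linarith [(hc s (hsub s hs)).1]
  · rw [Metric.tendstoUniformlyOn_iff]
    intro η hη
    filter_upwards [conv b ⟨hb0, hb1⟩ (η / 2) (by positivity)] with c hc s hs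
    rw [Real.dist_eq, abs_sub_comm, sub_sub_sub_cancel_right]
    linarith [(hc s (hsub s hs)).2 hs.2]
  · intro x hx hx0 hx0'
    have := (hu c₀).eq_of_cauchy_data hG hw ha0 hx.1 (hsub x hx).2 (sub_eq_zero.1 hx0)
      (sub_eq_zero.1 hx0')
    have e1 := hwa a ha0 le_rfl
    have e2 := hM a ⟨ha0.le, ha1.le⟩
    rw [Real.norm_eq_abs] at e2
    linarith [le_abs_self (u c₀ a)]
  · intro h
    have e1 := hwa a ha0 le_rfl
    have e2 := hM a ⟨ha0.le, ha1.le⟩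
    rw [Real.norm_eq_abs] at e2
    linarith [le_abs_self (u c₀ a)]
  · intro h
    have e1 := hwb b ⟨le_rfl, hb1⟩
    rw [h, abs_zero] at e1
    linarith

theorem isRadialSol_singular {m : ℕ} {α q b : ℝ} (hm : (m : ℝ) = 2 * (α + 1)) (hq : α * q = 2)
    (hb : 0 < b) (hbq : b ^ q = α * (α + 1)) :
    IsRadialSol m (fun x => α * (α + 1) * x - |x| ^ q * x) (fun ρ => b * ρ ^ (-α))
      (fun ρ => b * (-α * ρ ^ (-α - 1))) := by
  intro s hs
  have hs0 : 0 < s := hs.1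
  have hs1 : 0 < 1 - s ^ 2 := by nlinarith [hs.1, hs.2]
  refine ⟨(Real.hasDerivAt_rpow_const (Or.inl hs0.ne')).const_mul b, ?_⟩
  refine (((Real.hasDerivAt_rpow_const (p := -α - 1) (Or.inl hs0.ne')).const_mul
    (-α)).const_mul b).congr_deriv ?_
  have e1 : s ^ (-α - 1) = s ^ (-α) / s := Real.rpow_sub_one hs0.ne' _
  have e2 : s ^ (-α - 1 - 1) = s ^ (-α) / s / s := by rw [Real.rpow_sub_one hs0.ne', e1]
  have e3 : |b * s ^ (-α)| ^ q = α * (α + 1) / s ^ 2 := by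
    rw [abs_of_pos (by positivity), Real.mul_rpow hb.le (by positivity), hbq, ← Real.rpow_mul hs0.le,
      neg_mul, hq, Real.rpow_neg hs0.le, Real.rpow_two, div_eq_mul_inv]
  beta_reduce
  rw [e2, e1, e3, hm]
  field_simp
  ring

theorem isRadialSol_of_isSolOn {N m : ℕ} {p : ℝ} {u : ℝ → ℝ} (hmN : (m : ℝ) = N - 1)
    (hm : (m : ℝ) = 2 * (alphaP p + 1)) (hu : ContDiffOn ℝ 2 u (Ico 0 1))
    (hsol : IsSolOn N p u (Ioo 0 1)) :
    IsRadialSol m (fun x => alphaP p * (alphaP p + 1) * x - |x| ^ (p - 1) * x) u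
      (derivWithin u (Ico 0 1)) ∧ ContinuousOn (derivWithin u (Ico 0 1)) (Ico 0 1) := by
  refine ⟨fun s hs => ?_, hu.continuousOn_derivWithin (uniqueDiffOn_Ico 0 1) (by norm_num)⟩
  have hnhds : ∀ t ∈ Ioo (0 : ℝ) 1, Ico (0 : ℝ) 1 ∈ 𝓝 t := fun t ht => Ico_mem_nhds ht.1 ht.2
  have hat : ContDiffAt ℝ 2 u s := hu.contDiffAt (hnhds s hs)
  have heq : derivWithin u (Ico 0 1) =ᶠ[𝓝 s] deriv u := by
    filter_upwards [Ioo_mem_nhds hs.1 hs.2] with t ht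
    exact derivWithin_of_mem_nhds (hnhds t ht)
  have hd2 : DifferentiableAt ℝ (deriv u) s :=
    (((hu.mono Ioo_subset_Ico_self).deriv_of_isOpen (m := 1) isOpen_Ioo
      (by norm_num)).contDiffAt (Ioo_mem_nhds hs.1 hs.2)).differentiableAt (by norm_num)
  rw [heq.self_of_nhds]
  refine ⟨(hat.differentiableAt (by norm_num)).hasDerivAt, ?_⟩
  refine (hd2.hasDerivAt.congr_of_eventuallyEq heq).congr_deriv ?_
  have h := hsol s hs
  have hs0 : s ≠ 0 := hs.1.ne'
  have hs1 : 1 - s ^ 2 ≠ 0 := by nlinarith [hs.1, hs.2]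
  rw [← hmN, mul_assoc] at h
  have h3 : (m : ℝ) / s - 2 * ((alphaP p + 1) * s) = m / s * (1 - s ^ 2) := by
    rw [← mul_assoc, ← hm]
    field_simp
  rw [h3] at h
  have h4 : (alphaP p * (alphaP p + 1) * u s - |u s| ^ (p - 1) * u s) =
      (1 - s ^ 2) * (deriv (deriv u) s + m / s * deriv u s) := by linear_combination -h
  simp only
  rw [h4, mul_div_cancel_left₀ _ hs1]
  ring

theorem stmt15 (N : ℕ) (p : ℝ) (hN : 4 ≤ N) (hp : p = 1 + 4 / ((N : ℝ) - 3))
    (u : ℝ → ℝ → ℝ)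
    (hu : ∀ c : ℝ,
      ContDiffOn ℝ 2 (u c) (Ico 0 1) ∧
      IsSolOn N p (u c) (Ioo 0 1) ∧
      u c 0 = c ∧
      derivWithin (u c) (Ici 0) 0 = 0 ∧
      ContinuousOn (u c) (Icc 0 1))
    (c₀ : ℝ) (h1 : 0 < u c₀ 1) (h2 : u c₀ 1 ≠ b0 p) :
    ∃ δ > 0, ∀ c : ℝ, |c - c₀| < δ →
      {ρ ∈ Ioo (0 : ℝ) 1 | u c ρ / uInf N p ρ - 1 = 0}.encard =
      {ρ ∈ Ioo (0 : ℝ) 1 | u c₀ ρ / uInf N p ρ - 1 = 0}.encard := by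
  have hN' : (4 : ℝ) ≤ N := by exact_mod_cast hN
  have hN3 : (0 : ℝ) < N - 3 := by linarith
  have hq : p - 1 = 4 / ((N : ℝ) - 3) := by rw [hp]; ring
  have hα : alphaP p = ((N : ℝ) - 3) / 2 := by
    rw [alphaP, hq]
    field_simp
    norm_num
  have hα0 : 0 < alphaP p := by rw [hα]; positivity
  have hq0 : 0 < p - 1 := by rw [hq]; positivity
  have hαq : alphaP p * (p - 1) = 2 := by rw [hα, hq]; field_simp; norm_num
  obtain ⟨m, rfl⟩ : ∃ m, N = m + 1 := ⟨N - 1, by omega⟩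
  have hmN : (m : ℝ) = ((m + 1 : ℕ) : ℝ) - 1 := by push_cast; ring
  have hmα : (m : ℝ) = 2 * (alphaP p + 1) := by rw [hα]; push_cast; ring
  have hk : alphaP p * (((m + 1 : ℕ) : ℝ) - 2 - alphaP p) = alphaP p * (alphaP p + 1) := by
    rw [← sub_eq_zero]
    push_cast
    rw [hmα]
    ring
  have hk0 : 0 < alphaP p * (alphaP p + 1) := by positivity
  have hb : bInf (m + 1) p = (alphaP p * (alphaP p + 1)) ^ (alphaP p / 2) := by rw [bInf, hk]
  have hb0 : 0 < bInf (m + 1) p := by rw [hb]; positivity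
  have hbq : bInf (m + 1) p ^ (p - 1) = alphaP p * (alphaP p + 1) := by
    rw [hb, ← Real.rpow_mul hk0.le, div_mul_eq_mul_div, hαq, div_self two_ne_zero, Real.rpow_one]
  have hb0b : b0 p = bInf (m + 1) p := by
    rw [hb, b0]
    congr 1
    · rw [alphaP]
      field_simp
      ring
    · rw [alphaP]
      field_simp
  have hpos : ∀ ρ ∈ Ioo (0 : ℝ) 1, 0 < uInf (m + 1) p ρ := fun ρ hρ =>
    mul_pos hb0 (Real.rpow_pos_of_pos hρ.1 _)
  have hset : ∀ c, {ρ ∈ Ioo (0 : ℝ) 1 | u c ρ / uInf (m + 1) p ρ - 1 = 0} =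
      {ρ ∈ Ioo (0 : ℝ) 1 | u c ρ - uInf (m + 1) p ρ = 0} := by
    intro c
    ext ρ
    simp only [mem_ofPred_eq]
    refine and_congr_right fun hρ => ?_
    rw [sub_eq_zero, sub_eq_zero, div_eq_one_iff_eq (hpos ρ hρ).ne']
  have hrad := fun c => isRadialSol_of_isSolOn hmN hmα (hu c).1 (hu c).2.1
  have main := eventually_encard_intersections_eq (m := m) (by omega)
    (exists_lipschitz_const_nonlinearity hq0 (alphaP p * (alphaP p + 1)))
    (fun c => (hrad c).1) (isRadialSol_singular hmα hαq hb0 hbq) (fun c => (hu c).2.2.2.2)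
    (fun c => (hrad c).2) (fun c => (hu c).2.2.1)
    (fun ρ hρ => ((Real.continuousAt_rpow_const ρ _
      (Or.inl hρ.1.ne')).const_mul _).continuousWithinAt)
    ((tendsto_rpow_neg_nhdsGT_zero (neg_lt_zero.2 hα0)).const_mul_atTop hb0) (c₀ := c₀)
    (by rwa [Real.one_rpow, mul_one, ← hb0b])
  obtain ⟨δ, hδ, h⟩ := Metric.eventually_nhds_iff.1 main
  refine ⟨δ, hδ, fun c hc => ?_⟩
  rw [hset, hset]
  exact h (by rwa [Real.dist_eq])
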